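/- Let p be an odd prime, q = p^e with e ≥ 1, and let 1 ≤ k ≤ q - 1 with gcd(k, q-1) = 1. Let k' ∈ {1,...,q-2} with k'·k ≡ 1 (mod q-1). Then A_k is a permutation polynomial of F_q if and only if A_{k'} is a permutation polynomial of F_q. -/

import Mathlib

section

open Finset

theorem pow_eq_pow_of_modEq_card_sub_one {F : Type*} [Field F] [Fintype F] (x : F) {a b : ℕ}
    (ha : 0 < a) (hb : 0 < b) (h : a ≡ b [MOD Fintype.card F - 1]) : x ^ a = x ^ b := by
  rcases eq_or_ne x 0 with rfl | hx
  · rw [zero_pow ha.ne', zero_pow hb.ne']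
  · exact pow_eq_pow_of_modEq h (FiniteField.pow_card_sub_one_eq_one x hx)

theorem sum_one_add_pow_mul_inv_pow {F : Type*} [Field F] [Fintype F] [DecidableEq F] {r n : ℕ}
    (hr : r ≤ Fintype.card F - 1) (hn : 0 < n) (hnQ : n < Fintype.card F - 1) :
    ∑ w : Fˣ, (1 + (w : F)) ^ r * (w : F)⁻¹ ^ n = -(r.choose n : F) := by
  set Q := Fintype.card F - 1 with hQ
  have hinv (w : Fˣ) : (w : F)⁻¹ ^ n = (w : F) ^ (Q - n) := by
    rw [inv_pow, eq_comm, ← mul_eq_one_iff_eq_inv₀ (pow_ne_zero _ w.ne_zero), ← pow_add,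
      Nat.sub_add_cancel hnQ.le]
    exact FiniteField.pow_card_sub_one_eq_one _ w.ne_zero
  have hterm (w : Fˣ) : (1 + (w : F)) ^ r * (w : F)⁻¹ ^ n
      = ∑ j ∈ range (r + 1), (r.choose j : F) * (w : F) ^ (j + (Q - n)) := by
    rw [hinv, add_comm, add_pow, sum_mul]
    refine sum_congr rfl fun j _ => ?_
    rw [pow_add]; ring
  simp_rw [hterm]
  rw [sum_comm]
  have hsum : ∀ j ∈ range (r + 1), ∑ w : Fˣ, (r.choose j : F) * (w : F) ^ (j + (Q - n))
      = if j = n then -(r.choose n : F) else 0 := by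
    intro j hj
    rw [← mul_sum, FiniteField.sum_pow_units, ← hQ]
    have hjr : j ≤ r := Nat.lt_succ_iff.mp (mem_range.mp hj)
    have hiff : Q ∣ j + (Q - n) ↔ j = n := by
      constructor
      · rintro ⟨c, hc⟩
        have hc1 : c = 1 := by
          have : 0 < c := by
            rcases Nat.eq_zero_or_pos c with rfl | h
            · omega
            · exact h
          have : c < 2 := by
            by_contra h2
            have : Q * 2 ≤ Q * c := Nat.mul_le_mul_left _ (by omega)
            omega
          omega
        subst hc1
        omega
      · rintro rfl
        exact ⟨1, by omega⟩
    simp only [hiff]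
    split_ifs with h
    · rw [h]; ring
    · simp
  rw [sum_congr rfl hsum, sum_ite_eq']
  split_ifs with h
  · rfl
  · rw [Nat.choose_eq_zero_of_lt (by simpa using h)]; simp

theorem sum_units_pow_eq_zero_of_bijective {F : Type*} [Field F] [Fintype F] [DecidableEq F]
    {k K T : ℕ}
    (hk : 0 < k) (hK : 0 < K) (hinv : k * K ≡ 1 [MOD Fintype.card F - 1])
    (hbij : Function.Bijective (fun x : F => x ^ k * ((x + 1) ^ k - x ^ k)))
    (hT : ¬ Fintype.card F - 1 ∣ T) :
    ∑ w : Fˣ, ((1 + (w : F)) ^ K - 1) ^ (2 * T) * (w : F)⁻¹ ^ (K * T) = 0 := by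
  have hpow (x : F) : (x ^ K) ^ k = x := by
    rw [← pow_mul, mul_comm K k,
      pow_eq_pow_of_modEq_card_sub_one x (Nat.mul_pos hk hK) one_pos hinv, pow_one]
  have hpow_inv (x : F) : (x ^ k) ^ K = x := by rw [← pow_mul, mul_comm, pow_mul, hpow]
  have hE (w : Fˣ) : (1 + (w : F)) ^ K - 1 ≠ 0 := by
    intro h
    have h1 := congrArg (· ^ k) (sub_eq_zero.mp h)
    simp only [hpow, one_pow] at h1
    simp at h1
  let m : Fˣ → Fˣ := fun w => Units.mk0 _ (hE w) ^ (2 * k) * w⁻¹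
  have hm (w : Fˣ) : ((m w : Fˣ) : F) = ((1 + (w : F)) ^ K - 1) ^ (2 * k) * (w : F)⁻¹ := by
    simp [m]
  have hA (w : Fˣ) : ((1 + (w : F)) ^ K - 1)⁻¹ ^ k *
      ((((1 + (w : F)) ^ K - 1)⁻¹ + 1) ^ k - ((1 + (w : F)) ^ K - 1)⁻¹ ^ k)
      = ((m w : Fˣ) : F)⁻¹ := by
    have h1 : ((1 + (w : F)) ^ K - 1)⁻¹ + 1
        = (1 + (w : F)) ^ K * ((1 + (w : F)) ^ K - 1)⁻¹ := by
      field_simp [hE w]; ring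
    rw [h1, mul_pow, hpow, hm, mul_inv, inv_inv, ← inv_pow]
    ring
  have hinj : Function.Injective m := by
    intro w w' h
    have h1 : ((1 + (w : F)) ^ K - 1)⁻¹ = ((1 + (w' : F)) ^ K - 1)⁻¹ :=
      hbij.injective (by simp only [hA, h])
    have h2 := congrArg (· ^ k) (sub_left_injective (inv_injective h1))
    simp only [hpow] at h2
    exact Units.ext (add_left_cancel h2)
  have hbm : Function.Bijective m := Finite.injective_iff_bijective.mp hinj
  have hs := hbm.sum_comp (fun y : Fˣ => (y : F) ^ (K * T))
  have hd : ¬ Fintype.card F - 1 ∣ K * T := by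
    intro hd
    apply hT
    have hc : Nat.Coprime (Fintype.card F - 1) K := by
      have : Nat.gcd (k * K) (Fintype.card F - 1) = 1 := by
        rw [hinv.gcd_eq]; simp
      exact (Nat.Coprime.coprime_mul_left this).symm
    exact hc.dvd_of_dvd_mul_left hd
  rw [FiniteField.sum_pow_units, if_neg hd] at hs
  rw [← hs]
  refine sum_congr rfl fun w _ => ?_
  rw [hm, mul_pow, ← pow_mul, show 2 * k * (K * T) = k * (K * (2 * T)) by ring, pow_mul _ k,
    pow_mul _ K (2 * T), hpow_inv]

/-- Expanding the power sums of a permutation polynomial in base `p` blocks gives a binomial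
identity modulo `p`. -/
theorem sum_choose_mul_choose_eq_zero {F : Type*} [Field F] [Fintype F] [DecidableEq F]
    {p : ℕ} [Fact p.Prime]
    [CharP F p] {k K b L t₁ t₂ : ℕ} (r : ℕ → ℕ → ℕ)
    (hk : 0 < k) (hK : 0 < K) (hL : 0 < L) (hinv : k * K ≡ 1 [MOD Fintype.card F - 1])
    (hbij : Function.Bijective (fun x : F => x ^ k * ((x + 1) ^ k - x ^ k)))
    (hLK : L ≡ p ^ b * K [MOD Fintype.card F - 1])
    (hT : ¬ Fintype.card F - 1 ∣ t₁ + p ^ b * t₂)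
    (hn : 0 < t₁ * K + t₂ * L) (hnQ : t₁ * K + t₂ * L < Fintype.card F - 1)
    (hr : ∀ i j, r i j ≤ Fintype.card F - 1)
    (hrmod : ∀ i j, r i j ≡ i * K + j * L [MOD Fintype.card F - 1])
    (hr0 : ∀ i j, r i j = 0 ↔ i * K + j * L = 0) :
    ∑ i ∈ range (2 * t₁ + 1), ∑ j ∈ range (2 * t₂ + 1),
      ((-1 : F) ^ (i + 2 * t₁) * (-1 : F) ^ (j + 2 * t₂) * ((2 * t₁).choose i : F) *
        ((2 * t₂).choose j : F) * ((r i j).choose (t₁ * K + t₂ * L) : F)) = 0 := by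
  set n := t₁ * K + t₂ * L with hndef
  have hp : 0 < p := (Fact.out : p.Prime).pos
  have key := sum_units_pow_eq_zero_of_bijective hk hK hinv hbij hT
  have hTpos : 0 < t₁ + p ^ b * t₂ := by
    rcases Nat.eq_zero_or_pos (t₁ + p ^ b * t₂) with h | h
    · exact absurd (h ▸ dvd_zero _) hT
    · exact h
  have hnmod : K * (t₁ + p ^ b * t₂) ≡ n [MOD Fintype.card F - 1] := by
    have := (hLK.mul_left t₂).add_left (t₁ * K)
    refine Nat.ModEq.trans ?_ this.symm
    rw [show K * (t₁ + p ^ b * t₂) = t₁ * K + t₂ * (p ^ b * K) by ring]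
  have hterm (w : Fˣ) :
      ((1 + (w : F)) ^ K - 1) ^ (2 * (t₁ + p ^ b * t₂)) * (w : F)⁻¹ ^ (K * (t₁ + p ^ b * t₂))
      = ∑ i ∈ range (2 * t₁ + 1), ∑ j ∈ range (2 * t₂ + 1),
        ((-1 : F) ^ (i + 2 * t₁) * (-1 : F) ^ (j + 2 * t₂) * ((2 * t₁).choose i : F) *
        ((2 * t₂).choose j : F)) * ((1 + (w : F)) ^ r i j * (w : F)⁻¹ ^ n) := by
    have h1 : ((1 + (w : F)) ^ K - 1) ^ p ^ b = (1 + (w : F)) ^ L - 1 := by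
      rw [sub_pow_char_pow, one_pow, ← pow_mul,
        pow_eq_pow_of_modEq_card_sub_one (1 + (w : F)) hL (by positivity) hLK, mul_comm K]
    rw [pow_eq_pow_of_modEq_card_sub_one (w : F)⁻¹ (Nat.mul_pos hK hTpos) hn hnmod,
      show 2 * (t₁ + p ^ b * t₂) = 2 * t₁ + p ^ b * (2 * t₂) by ring, pow_add, pow_mul _ (p ^ b),
      h1, sub_pow, sub_pow, sum_mul_sum, sum_mul]
    refine sum_congr rfl fun i _ => ?_
    rw [sum_mul]
    refine sum_congr rfl fun j _ => ?_
    have h2 : (1 + (w : F)) ^ r i j = ((1 + (w : F)) ^ K) ^ i * ((1 + (w : F)) ^ L) ^ j := by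
      rw [← pow_mul, ← pow_mul, ← pow_add, mul_comm K, mul_comm L]
      rcases Nat.eq_zero_or_pos (r i j) with h | h
      · rw [h, (hr0 i j).mp h]
      · exact pow_eq_pow_of_modEq_card_sub_one _ h
          (Nat.pos_of_ne_zero fun h' => h.ne' ((hr0 i j).mpr h')) (hrmod i j)
    rw [h2]
    simp only [one_pow, mul_one]
    ring
  simp_rw [hterm] at key
  rw [sum_comm] at key
  rw [← neg_eq_zero, ← key, ← sum_neg_distrib]
  refine sum_congr rfl fun i _ => ?_
  rw [sum_comm, ← sum_neg_distrib]
  refine sum_congr rfl fun j _ => ?_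
  rw [← mul_sum, sum_one_add_pow_mul_inv_pow (hr i j) hn hnQ]
  ring

theorem mod_pow_add_mod_pow_lt_of_not_dvd_choose {p n m : ℕ} (hp : p.Prime)
    (h : ¬ p ∣ (n + m).choose n) (i : ℕ) : n % p ^ i + m % p ^ i < p ^ i := by
  rcases Nat.eq_zero_or_pos i with rfl | hi
  · simp [Nat.mod_one]
  by_contra hlt
  push Not at hlt
  have h0 := Nat.factorization_eq_zero_of_not_dvd h
  rw [add_comm, Nat.factorization_choose' (b := max (Nat.log p (m + n) + 1) (i + 1)) hp
    (by omega), card_eq_zero] at h0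
  have : i ∈ ({j ∈ Ico 1 (max (Nat.log p (m + n) + 1) (i + 1)) |
      p ^ j ≤ n % p ^ j + m % p ^ j} : Finset ℕ) := by
    simp only [mem_filter, mem_Ico]
    exact ⟨⟨hi, by omega⟩, hlt⟩
  rw [h0] at this
  simp at this

theorem sum_digits_add_of_forall_mod_pow_add_lt {p n m : ℕ} (hp : p.Prime)
    (h : ∀ i, n % p ^ i + m % p ^ i < p ^ i) :
    (p.digits (n + m)).sum = (p.digits n).sum + (p.digits m).sum := by
  have : Fact p.Prime := ⟨hp⟩
  have hv : padicValNat p ((n + m).choose m) = 0 := by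
    rw [← Nat.factorization_def _ hp,
      Nat.factorization_choose' (b := Nat.log p (n + m) + 1) hp (by omega), card_eq_zero,
      filter_eq_empty_iff]
    intro i _
    have := h i
    omega
  have hc : padicValNat p (n + m).factorial
      = padicValNat p n.factorial + padicValNat p m.factorial := by
    have h1 := Nat.add_choose_mul_factorial_mul_factorial n m
    rw [← h1, padicValNat.mul (mul_ne_zero (Nat.choose_pos (Nat.le_add_left _ _)).ne'
      (Nat.factorial_ne_zero _)) (Nat.factorial_ne_zero _), padicValNat.mul
      (Nat.choose_pos (Nat.le_add_left _ _)).ne' (Nat.factorial_ne_zero _), hv, zero_add]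
  have h1 := sub_one_mul_padicValNat_factorial (p := p) (n + m)
  have h2 := sub_one_mul_padicValNat_factorial (p := p) n
  have h3 := sub_one_mul_padicValNat_factorial (p := p) m
  rw [hc, mul_add, h2, h3] at h1
  have := Nat.digit_sum_le p n
  have := Nat.digit_sum_le p m
  have := Nat.digit_sum_le p (n + m)
  omega

theorem sum_digits_add_pow_mul {p a b j : ℕ} (hp : p.Prime) (ha : a < p ^ j) :
    (p.digits (a + p ^ j * b)).sum = (p.digits a).sum + (p.digits b).sum := by
  rw [sum_digits_add_of_forall_mod_pow_add_lt hp]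
  · congr 1
    rcases Nat.eq_zero_or_pos b with rfl | hb
    · simp
    · rw [Nat.digits_base_pow_mul hp.one_lt hb]; simp
  · intro i
    have hpi : 0 < p ^ i := pow_pos hp.pos _
    rcases le_total i j with hij | hij
    · have : p ^ j * b % p ^ i = 0 :=
        Nat.mod_eq_zero_of_dvd ((pow_dvd_pow p hij).mul_right b)
      rw [this, add_zero]
      exact Nat.mod_lt _ hpi
    · obtain ⟨c, rfl⟩ := Nat.exists_eq_add_of_le hij
      have hle : p ^ j ≤ p ^ (j + c) := Nat.pow_le_pow_right hp.pos hij
      rw [Nat.mod_eq_of_lt (ha.trans_le hle), pow_add, Nat.mul_mod_mul_left]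
      have hlt : b % p ^ c + 1 ≤ p ^ c := Nat.mod_lt _ (pow_pos hp.pos _)
      have := Nat.mul_le_mul_left (p ^ j) hlt
      rw [mul_add, mul_one] at this
      omega

theorem mul_mod_of_mul_mod_lt {t K P : ℕ} (h : t * (K % P) < P) : t * K % P = t * (K % P) := by
  rw [← Nat.mul_mod_mod, Nat.mod_eq_of_lt h]

theorem sub_one_mul_mod_pow_lt {p n : ℕ} (hp : p.Prime) (h : ∀ a, n / p ^ a % p ≤ 1) (i : ℕ) :
    (p - 1) * (n % p ^ i) < p ^ i := by
  induction i with
  | zero => simp [Nat.mod_one]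
  | succ i ih =>
    obtain ⟨c, rfl⟩ : ∃ c, p = c + 1 := ⟨p - 1, by have := hp.pos; omega⟩
    rw [Nat.mod_pow_succ]
    have h1 : (c + 1) ^ i * (n / (c + 1) ^ i % (c + 1)) ≤ (c + 1) ^ i * 1 :=
      Nat.mul_le_mul_left _ (h i)
    simp only [Nat.add_sub_cancel] at ih ⊢
    rw [pow_succ]
    nlinarith

theorem mod_pow_div_pow_mod {p n i j : ℕ} (h : i < j) :
    n % p ^ j / p ^ i % p = n / p ^ i % p := by
  obtain ⟨c, rfl⟩ := Nat.exists_eq_add_of_lt h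
  rw [add_assoc, pow_add, Nat.mod_mul_right_div_self, Nat.mod_mod_of_dvd]
  exact dvd_pow_self p (by omega)

theorem eq_of_add_mul_eq_mul {p a h m u z L M : ℕ} (hp : p.Prime) (hh : 2 * h = p - 1)
    (hL : L / p ^ a % p = 1) (hM : M / p ^ a % p = 1)
    (hs : (p.digits L).sum = (p.digits M).sum)
    (hnc : ∀ i, m % p ^ i + (h * (L % p ^ i) + h * (M % p ^ i)) < p ^ i)
    (hu : 0 < u) (huh : u ≤ h) (hzh : z ≤ h) (heq : m + z * M = u * L) : L = M := by
  have hmod (i : ℕ) : m % p ^ i + z * (M % p ^ i) = u * (L % p ^ i) := by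
    have h1 := hnc i
    have h2 : z * (M % p ^ i) ≤ h * (M % p ^ i) := Nat.mul_le_mul_right _ hzh
    have h3 : u * (L % p ^ i) ≤ h * (L % p ^ i) := Nat.mul_le_mul_right _ huh
    have h4 : m % p ^ i + z * (M % p ^ i) ≡ u * (L % p ^ i) [MOD p ^ i] :=
      ((Nat.mod_modEq m _).add ((Nat.mod_modEq M _).mul_left z)).trans
        ((heq ▸ Nat.ModEq.refl _ : m + z * M ≡ u * L [MOD p ^ i]).trans
          ((Nat.mod_modEq L _).symm.mul_left u))
    have h5 := Nat.zero_le (m % p ^ i)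
    have h6 := Nat.zero_le (h * (L % p ^ i))
    have h7 := Nat.zero_le (h * (M % p ^ i))
    exact Nat.ModEq.eq_of_lt_of_lt h4 (by linarith) (by linarith)
  have hzu : z = u := by
    have h1 := hmod (a + 1)
    have h0 := hmod a
    have hb := hnc (a + 1)
    have hP : 0 < p ^ a := pow_pos hp.pos a
    have hp1 : p = 2 * h + 1 := by have := hp.pos; omega
    rw [Nat.mod_pow_succ (x := L), Nat.mod_pow_succ (x := M), hL, hM] at hb h1
    have hm : m % p ^ (a + 1) < p ^ a := by
      have : p ^ (a + 1) = p ^ a * (2 * h + 1) := by rw [pow_succ, ← hp1]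
      rw [this] at hb ⊢
      nlinarith [Nat.zero_le (h * (L % p ^ a)), Nat.zero_le (h * (M % p ^ a))]
    have hm' : m % p ^ (a + 1) = m % p ^ a := by
      rw [← Nat.mod_eq_of_lt hm, Nat.mod_mod_of_dvd _ (pow_dvd_pow p a.le_succ)]
    rw [hm'] at h1
    have : p ^ a * z = p ^ a * u := by nlinarith
    exact Nat.eq_of_mul_eq_mul_left hP this
  subst hzu
  have hML : M ≤ L := Nat.le_of_mul_le_mul_left (by omega : z * M ≤ z * L) hu
  obtain ⟨D, rfl⟩ := Nat.exists_eq_add_of_le hML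
  have hMD (i : ℕ) : M % p ^ i + D % p ^ i < p ^ i := by
    have h1 := hmod i
    have hpi : 0 < p ^ i := pow_pos hp.pos i
    have h2 : M % p ^ i ≤ (M + D) % p ^ i :=
      Nat.le_of_mul_le_mul_left (h1 ▸ Nat.le_add_left _ _) hu
    have h3 := Nat.mod_lt M hpi
    have h4 := Nat.mod_lt D hpi
    by_contra hlt
    have h5 := Nat.add_mod_add_of_le_add_mod (not_lt.mp hlt)
    linarith
  rw [sum_digits_add_of_forall_mod_pow_add_lt hp hMD] at hs
  have hD : (p.digits D).sum = 0 := by omega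
  suffices D = 0 by omega
  by_contra hD0
  have hl := Nat.getLast_digit_ne_zero p hD0
  have := List.sum_eq_zero_iff.mp hD _ (List.getLast_mem (Nat.digits_ne_nil_iff_ne_zero.mpr hD0))
  exact hl this

/-- If `A_k` is a permutation polynomial, then the binomial identity for `(t₁, t₂)` has a nonzero
term other than the central one. -/
theorem exists_not_dvd_choose_of_bijective {F : Type*} [Field F] [Fintype F] {p e : ℕ}
    (hp : p.Prime) (hF : Fintype.card F = p ^ e) {k K b L t₁ t₂ : ℕ}
    (hk : 0 < k) (hK : 0 < K) (hL : 0 < L) (hinv : k * K ≡ 1 [MOD p ^ e - 1])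
    (hbij : Function.Bijective (fun x : F => x ^ k * ((x + 1) ^ k - x ^ k)))
    (hLK : L ≡ p ^ b * K [MOD p ^ e - 1]) (hT : ¬ p ^ e - 1 ∣ t₁ + p ^ b * t₂)
    (hn : 0 < t₁ * K + t₂ * L) (hnQ : t₁ * K + t₂ * L < p ^ e - 1)
    (ht₁ : 2 * t₁ < p) (ht₂ : 2 * t₂ < p) :
    ∃ i j, i ≤ 2 * t₁ ∧ j ≤ 2 * t₂ ∧ (i ≠ t₁ ∨ j ≠ t₂) ∧
      t₁ * K + t₂ * L ≤ i * K + j * L ∧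
      ¬ p ∣ (i * K + j * L).choose (t₁ * K + t₂ * L) := by
  classical
  have : Fact p.Prime := ⟨hp⟩
  have : CharP F p := charP_of_card_eq_prime_pow hF
  set Q := p ^ e - 1 with hQ
  set n := t₁ * K + t₂ * L with hndef
  have hQ0 : 0 < Q := by omega
  let r : ℕ → ℕ → ℕ := fun i j =>
    if i * K + j * L = 0 then 0 else (i * K + j * L - 1) % Q + 1
  have hr (i j : ℕ) : r i j ≤ Q := by
    simp only [r]
    split_ifs
    · omega
    · exact Nat.mod_lt _ hQ0
  have hr0 (i j : ℕ) : r i j = 0 ↔ i * K + j * L = 0 := by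
    simp only [r]
    split_ifs with h
    · exact ⟨fun _ => h, fun _ => rfl⟩
    · exact ⟨fun h' => h'.elim, fun h' => absurd h' h⟩
  have hrmod (i j : ℕ) : r i j ≡ i * K + j * L [MOD Q] := by
    simp only [r]
    split_ifs with h
    · rw [h]
    · have := (Nat.mod_modEq (i * K + j * L - 1) Q).add_right 1
      rwa [Nat.sub_add_cancel (Nat.pos_of_ne_zero h)] at this
  have hreq (i j : ℕ) (hi : i ≤ 2 * t₁) (hj : j ≤ 2 * t₂) (h : n ≤ r i j) :
      r i j = i * K + j * L := by
    have h1 : i * K ≤ 2 * t₁ * K := Nat.mul_le_mul_right _ hi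
    have h2 : j * L ≤ 2 * t₂ * L := Nat.mul_le_mul_right _ hj
    have h3 : i * K + j * L ≤ 2 * n := by rw [hndef]; linarith
    have h4 := hr i j
    have h5 := (hr0 i j).mpr
    obtain ⟨c, hc⟩ := (Nat.modEq_iff_dvd.mp (hrmod i j))
    have hc1 : c < 1 := by
      by_contra hc1
      have : (Q : ℤ) * 1 ≤ Q * c := mul_le_mul_of_nonneg_left (by omega) (by omega)
      omega
    have hc2 : -1 < c := by
      by_contra hc2
      have : (Q : ℤ) * c ≤ Q * (-1) := mul_le_mul_of_nonneg_left (by omega) (by omega)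
      omega
    have : c = 0 := by omega
    subst this
    omega
  have key := sum_choose_mul_choose_eq_zero (F := F) (p := p) (b := b) (t₁ := t₁) (t₂ := t₂) r
    hk hK hL (hF ▸ hinv) hbij (hF ▸ hLK) (hF ▸ hT) hn (hF ▸ hnQ)
    (by rw [hF]; exact hr) (by rw [hF]; exact hrmod) hr0
  by_contra hcon
  push Not at hcon
  have hzero : ∀ i ∈ range (2 * t₁ + 1), ∀ j ∈ range (2 * t₂ + 1), (i ≠ t₁ ∨ j ≠ t₂) →
      ((r i j).choose n : F) = 0 := by
    intro i hi j hj hij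
    have hi' : i ≤ 2 * t₁ := Nat.lt_succ_iff.mp (mem_range.mp hi)
    have hj' : j ≤ 2 * t₂ := Nat.lt_succ_iff.mp (mem_range.mp hj)
    rcases lt_or_ge (r i j) n with h | h
    · rw [Nat.choose_eq_zero_of_lt h, Nat.cast_zero]
    · have he := hreq i j hi' hj' h
      rw [CharP.cast_eq_zero_iff F p, he]
      exact hcon i j hi' hj' hij (he ▸ h)
  have hcentral (t : ℕ) (ht : 2 * t < p) : ((2 * t).choose t : F) ≠ 0 := by
    rw [Ne, CharP.cast_eq_zero_iff F p]
    intro h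
    have h1 : (2 * t).choose t ∣ (2 * t).factorial :=
      ⟨_, (by rw [← mul_assoc]; exact (Nat.choose_mul_factorial_mul_factorial (by omega)).symm)⟩
    exact absurd (hp.dvd_factorial.mp (h.trans h1)) (by omega)
  rw [sum_eq_single t₁, sum_eq_single t₂] at key
  · have h1 : r t₁ t₂ = n := by
      have h2 := hrmod t₁ t₂
      simp only [r]
      rw [if_neg hn.ne', Nat.mod_eq_of_lt (by omega)]
      omega
    rw [h1, Nat.choose_self] at key
    have h2 := hcentral t₁ ht₁
    have h3 := hcentral t₂ ht₂
    simp [h2, h3] at key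
  · intro j hj hne
    rw [hzero t₁ (by simp; omega) j hj (Or.inr hne), mul_zero]
  · intro h; simp at h; omega
  · intro i hi hne
    exact sum_eq_zero fun j hj => by rw [hzero i hi j hj (Or.inl hne), mul_zero]
  · intro h; simp at h; omega

/-- If `A_k` is a permutation polynomial, the base `p` digits of the inverse of `k` are at most
`1`. -/
theorem digit_le_one_of_bijective {F : Type*} [Field F] [Fintype F] {p e : ℕ}
    (hp : p.Prime) (hodd : Odd p) (hF : Fintype.card F = p ^ e) {k K : ℕ} (hk : 0 < k)
    (hK : 0 < K) (hKQ : K < p ^ e - 1) (hinv : k * K ≡ 1 [MOD p ^ e - 1])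
    (hbij : Function.Bijective (fun x : F => x ^ k * ((x + 1) ^ k - x ^ k))) (a : ℕ) :
    K / p ^ a % p ≤ 1 := by
  classical
  obtain ⟨c, hc⟩ := hodd
  have hcop : Nat.Coprime (p ^ e - 1) K := by
    have h : Nat.gcd (k * K) (p ^ e - 1) = 1 := by rw [hinv.gcd_eq]; simp
    exact (Nat.Coprime.coprime_mul_left h).symm
  suffices h : ∀ i, (c + 1) * (K % p ^ i) < p ^ i by
    have h1 := h (a + 1)
    rw [Nat.mod_pow_succ, pow_succ] at h1
    by_contra h2
    have h3 : p ^ a * 2 ≤ p ^ a * (K / p ^ a % p) := Nat.mul_le_mul_left _ (by omega)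
    have h4 : (c + 1) * (p ^ a * 2) ≤ (c + 1) * (K % p ^ a + p ^ a * (K / p ^ a % p)) :=
      Nat.mul_le_mul_left _ (h3.trans (Nat.le_add_left _ _))
    have h5 : 0 < p ^ a := pow_pos hp.pos a
    have h6 : p ^ a * p = p ^ a * (2 * c + 1) := by rw [← hc]
    nlinarith
  by_contra hcon
  push Not at hcon
  have hex : ∃ N, ∃ i, p ^ i ≤ N * (K % p ^ i) := ⟨c + 1, hcon⟩
  obtain ⟨i₀, hi₀⟩ := Nat.find_spec hex
  have hle : Nat.find hex ≤ c + 1 := Nat.find_min' hex hcon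
  have hmin (t : ℕ) (ht : t < Nat.find hex) (i : ℕ) : t * (K % p ^ i) < p ^ i := by
    have := Nat.find_min hex ht
    push Not at this
    exact this i
  have htwo : 2 ≤ Nat.find hex := by
    by_contra h
    have h1 : Nat.find hex * (K % p ^ i₀) ≤ 1 * (K % p ^ i₀) := Nat.mul_le_mul_right _ (by omega)
    have := Nat.mod_lt K (pow_pos hp.pos i₀)
    omega
  obtain ⟨t, ht⟩ : ∃ t, Nat.find hex = t + 1 := ⟨Nat.find hex - 1, by omega⟩
  rw [ht] at hi₀ hmin hle htwo
  have hmod (j : ℕ) (hj : j ≤ t) (i : ℕ) : j * K % p ^ i = j * (K % p ^ i) :=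
    mul_mod_of_mul_mod_lt (hmin j (by omega) i)
  have hpe : p ≤ p ^ e := by
    rcases Nat.eq_zero_or_pos e with rfl | he
    · simp at hKQ
    · exact Nat.le_self_pow he.ne' p
  have hT : ¬ p ^ e - 1 ∣ t := fun h => absurd (Nat.le_of_dvd (by omega) h) (by omega)
  have hnQ : t * K < p ^ e - 1 := by
    have h1 := hmin t (by omega) e
    rw [Nat.mod_eq_of_lt (by omega)] at h1
    have h2 : t * K ≠ p ^ e - 1 := fun h =>
      hT (hcop.dvd_of_dvd_mul_right (h ▸ dvd_rfl))
    omega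
  have htK : 0 < t * K := Nat.mul_pos (by omega) hK
  obtain ⟨i, j, hi, hj, hne, hge, hdvd⟩ := exists_not_dvd_choose_of_bijective hp hF
    (b := 0) (L := K) (t₁ := t) (t₂ := 0) hk hK hK hinv hbij (by simp; rfl) (by simpa using hT)
    (by simpa using htK) (by simpa using hnQ) (by omega) (by omega)
  obtain rfl : j = 0 := by omega
  simp only [zero_mul, add_zero] at hge hdvd
  have hti : t ≤ i := Nat.le_of_mul_le_mul_right hge hK
  obtain ⟨d, rfl⟩ := Nat.exists_eq_add_of_le hti
  rw [add_mul] at hdvd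
  have h1 := mod_pow_add_mod_pow_lt_of_not_dvd_choose hp hdvd i₀
  rw [hmod t le_rfl, hmod d (by omega)] at h1
  have h2 : (t + 1) * (K % p ^ i₀) ≤ (t + d) * (K % p ^ i₀) :=
    Nat.mul_le_mul_right _ (by omega)
  rw [add_mul t d] at h2
  omega

set_option maxHeartbeats 1000000 in
/-- If `A_k` is a permutation polynomial, the inverse of `k` modulo `q - 1` is a power of `p`. -/
theorem eq_prime_pow_of_bijective {F : Type*} [Field F] [Fintype F] {p e : ℕ}
    (hp : p.Prime) (hodd : Odd p) (hF : Fintype.card F = p ^ e) {k K : ℕ} (hk : 0 < k)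
    (hK : 0 < K) (hKQ : K < p ^ e - 1) (hinv : k * K ≡ 1 [MOD p ^ e - 1])
    (hbij : Function.Bijective (fun x : F => x ^ k * ((x + 1) ^ k - x ^ k))) :
    ∃ a, K = p ^ a := by
  have hdig := digit_le_one_of_bijective hp hodd hF hk hK hKQ hinv hbij
  have hcop : Nat.Coprime (p ^ e - 1) K := by
    have h : Nat.gcd (k * K) (p ^ e - 1) = 1 := by rw [hinv.gcd_eq]; simp
    exact (Nat.Coprime.coprime_mul_left h).symm
  have hlead (n : ℕ) (hn : n ≠ 0) (h : ∀ a, n / p ^ a % p ≤ 1) :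
      n / p ^ Nat.log p n = 1 := by
    have h1 : 0 < n / p ^ Nat.log p n :=
      Nat.div_pos (Nat.pow_log_le_self p hn) (pow_pos hp.pos _)
    have h2 : n / p ^ Nat.log p n < p := by
      rw [Nat.div_lt_iff_lt_mul (pow_pos hp.pos _), ← pow_succ']
      exact Nat.lt_pow_succ_log_self hp.one_lt n
    have h3 := h (Nat.log p n)
    rw [Nat.mod_eq_of_lt h2] at h3
    omega
  by_contra hnot
  push Not at hnot
  have hK1 := hlead K hK.ne' hdig
  generalize Nat.log p K = c at hK1
  have hKc : K % p ^ c + p ^ c = K := by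
    have := Nat.mod_add_div K (p ^ c)
    rwa [hK1, mul_one] at this
  obtain ⟨R, hR⟩ : ∃ R, R = K % p ^ c := ⟨_, rfl⟩
  rw [← hR] at hKc
  have hR0 : R ≠ 0 := fun h => hnot c (by omega)
  have hRlt : R < p ^ c := hR ▸ Nat.mod_lt _ (pow_pos hp.pos _)
  obtain ⟨a, ha⟩ : ∃ a, a = Nat.log p R := ⟨_, rfl⟩
  have hac : a < c := ha ▸ Nat.log_lt_of_lt_pow hR0 hRlt
  have hRdig (i : ℕ) : R / p ^ i % p ≤ 1 := by
    rcases lt_or_ge i c with h | h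
    · rw [hR, mod_pow_div_pow_mod h]; exact hdig i
    · rw [Nat.div_eq_of_lt (hRlt.trans_le (Nat.pow_le_pow_right hp.pos h))]; simp
  have hKa : K / p ^ a % p = 1 := by
    rw [← mod_pow_div_pow_mod hac, ← hR, ha, hlead R hR0 hRdig, Nat.mod_eq_of_lt hp.one_lt]
  have hKc1 : K / p ^ c % p = 1 := by rw [hK1, Nat.mod_eq_of_lt hp.one_lt]
  have hce : c < e := by
    by_contra h
    have := Nat.pow_le_pow_right hp.pos (not_lt.mp h)
    omega
  obtain ⟨b, hb0, rfl⟩ : ∃ b, 0 < b ∧ c = a + b := ⟨c - a, by omega, by omega⟩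
  obtain ⟨f, rfl⟩ : ∃ f, e = f + b := ⟨e - b, by omega⟩
  -- `L` is the cyclic shift of the base `p` expansion of `K` by `b` places
  set A := K % p ^ f with hA
  set B := K / p ^ f with hB
  set L := B + p ^ b * A with hLdef
  have hKAB : A + p ^ f * B = K := Nat.mod_add_div K (p ^ f)
  have hAlt : A < p ^ f := Nat.mod_lt _ (pow_pos hp.pos _)
  have hBlt : B < p ^ b := by
    rw [hB, Nat.div_lt_iff_lt_mul (pow_pos hp.pos _), ← pow_add, add_comm b]
    omega
  have hLK : L ≡ p ^ b * K [MOD p ^ (f + b) - 1] := by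
    have h1 : p ^ b * K = L + (p ^ (f + b) - 1) * B := by
      have h2 : (p ^ (f + b) - 1) * B + B = p ^ (f + b) * B := by
        rw [← Nat.succ_mul, Nat.succ_eq_add_one, Nat.sub_add_cancel (by omega)]
      have h3 : p ^ b * K = p ^ b * A + p ^ (f + b) * B := by
        rw [← hKAB]; ring
      omega
    rw [h1]
    simp [Nat.ModEq]
  have hdigL (i : ℕ) : L / p ^ i % p
      = if i < b then K / p ^ (f + i) % p else A / p ^ (i - b) % p := by
    split_ifs with h
    · rw [← mod_pow_div_pow_mod h, hLdef, Nat.add_mul_mod_self_left, Nat.mod_eq_of_lt hBlt, hB,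
        Nat.div_div_eq_div_mul, ← pow_add]
    · obtain ⟨j, rfl⟩ := Nat.exists_eq_add_of_le (not_lt.mp h)
      rw [pow_add, ← Nat.div_div_eq_div_mul, hLdef, Nat.add_mul_div_left _ _ (pow_pos hp.pos _),
        Nat.div_eq_of_lt hBlt, zero_add, Nat.add_sub_cancel_left]
  have hAdig (i : ℕ) : A / p ^ i % p ≤ 1 := by
    rcases lt_or_ge i f with h | h
    · rw [hA, mod_pow_div_pow_mod h]; exact hdig i
    · rw [Nat.div_eq_of_lt (hAlt.trans_le (Nat.pow_le_pow_right hp.pos h))]; simp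
  have hLdig (i : ℕ) : L / p ^ i % p ≤ 1 := by
    rw [hdigL]
    split_ifs
    · exact hdig _
    · exact hAdig _
  have hLc : L / p ^ (a + b) % p = 1 := by
    rw [hdigL, if_neg (by omega), Nat.add_sub_cancel, hA, mod_pow_div_pow_mod (by omega), hKa]
  have hL0 : 0 < L := by
    rcases Nat.eq_zero_or_pos L with h | h
    · rw [h] at hLc; simp at hLc
    · exact h
  have hLlt : L < p ^ (f + b) := by
    have : p ^ b * (A + 1) ≤ p ^ b * p ^ f := Nat.mul_le_mul_left _ hAlt
    rw [mul_add, mul_one, ← pow_add, add_comm b f] at this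
    omega
  have hs : (p.digits K).sum = (p.digits L).sum := by
    rw [← hKAB, hLdef, sum_digits_add_pow_mul hp hAlt, sum_digits_add_pow_mul hp hBlt, add_comm]
  have hpb1 : 1 < p ^ b := Nat.one_lt_pow hb0.ne' hp.one_lt
  have hpf : p ≤ p ^ f := Nat.le_self_pow (by omega) p
  have hpfb : p ^ (f + b) = p ^ f * p ^ b := pow_add p f b
  have hne : K ≠ L := by
    intro h
    rw [← h] at hLK
    have h1 : p ^ (f + b) - 1 ∣ (p ^ b - 1) * K := by
      rw [Nat.sub_mul, one_mul]
      exact (Nat.modEq_iff_dvd' (Nat.le_mul_of_pos_left _ (by omega))).mp hLK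
    have h2 := Nat.le_of_dvd (by omega) (hcop.dvd_of_dvd_mul_right h1)
    have := hp.two_le
    have : p ^ b * 2 ≤ p ^ b * p ^ f := Nat.mul_le_mul_left _ (by omega)
    rw [mul_comm _ (p ^ f), ← hpfb] at this
    omega
  obtain ⟨h, hh⟩ := hodd
  have hh0 : 0 < h := by have := hp.two_le; omega
  have hp1 : p - 1 = 2 * h := by omega
  have hbd (i : ℕ) : h * (K % p ^ i) + h * (L % p ^ i) < p ^ i := by
    have h1 := sub_one_mul_mod_pow_lt hp hdig i
    have h2 := sub_one_mul_mod_pow_lt hp hLdig i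
    rw [hp1] at h1 h2
    linarith
  have hmod (u v : ℕ) (hu : u ≤ h) (hv : v ≤ h) (i : ℕ) :
      (u * K + v * L) % p ^ i = u * (K % p ^ i) + v * (L % p ^ i) := by
    have h1 := hbd i
    have h2 : u * (K % p ^ i) ≤ h * (K % p ^ i) := Nat.mul_le_mul_right _ hu
    have h3 : v * (L % p ^ i) ≤ h * (L % p ^ i) := Nat.mul_le_mul_right _ hv
    refine Nat.ModEq.eq_of_lt_of_lt ((Nat.mod_modEq _ _).trans ?_)
      (Nat.mod_lt _ (pow_pos hp.pos _)) (by linarith)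
    exact ((Nat.mod_modEq K _).symm.mul_left u).add ((Nat.mod_modEq L _).symm.mul_left v)
  have hT : ¬ p ^ (f + b) - 1 ∣ h + p ^ b * h := by
    intro hd
    have h1 := Nat.le_of_dvd (by positivity) hd
    have h2 : p * p ^ b ≤ p ^ (f + b) := hpfb ▸ Nat.mul_le_mul_right _ hpf
    have h3 : p ^ (f + b) ≤ h + p ^ b * h + 1 := by omega
    rw [hh] at h2 hpb1 h3
    nlinarith
  have hnQ : h * K + h * L < p ^ (f + b) - 1 := by
    have h1 := hbd (f + b)
    rw [Nat.mod_eq_of_lt (by omega : K < p ^ (f + b)), Nat.mod_eq_of_lt hLlt] at h1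
    have h2 : h * K + h * L ≠ p ^ (f + b) - 1 := by
      intro h2
      apply hT
      apply hcop.dvd_of_dvd_mul_right
      have h3 : h * K + h * L ≡ (h + p ^ b * h) * K [MOD p ^ (f + b) - 1] := by
        have := (hLK.mul_left h).add_left (h * K)
        rwa [show h * K + h * (p ^ b * K) = (h + p ^ b * h) * K by ring] at this
      rw [h2] at h3
      exact (h3.dvd_iff dvd_rfl).mp dvd_rfl
    omega
  obtain ⟨i, j, hi, hj, hij, hge, hdvd⟩ := exists_not_dvd_choose_of_bijective hp hF
    (b := b) (L := L) (t₁ := h) (t₂ := h) hk hK hL0 hinv hbij hLK hT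
    (by positivity) hnQ (by omega) (by omega)
  obtain ⟨m, hm⟩ := Nat.exists_eq_add_of_le hge
  rw [hm] at hdvd
  have hnc (l : ℕ) : m % p ^ l + (h * (K % p ^ l) + h * (L % p ^ l)) < p ^ l := by
    have := mod_pow_add_mod_pow_lt_of_not_dvd_choose hp hdvd l
    rw [hmod h h le_rfl le_rfl] at this
    omega
  rcases le_total h i with hi' | hi' <;> rcases le_total h j with hj' | hj'
  · obtain ⟨u, rfl⟩ := Nat.exists_eq_add_of_le hi'
    obtain ⟨v, rfl⟩ := Nat.exists_eq_add_of_le hj'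
    obtain rfl : m = u * K + v * L := by linarith
    have h1 := hnc (a + b + 1)
    rw [hmod u v (by omega) (by omega), Nat.mod_pow_succ (x := K), Nat.mod_pow_succ (x := L),
      hKc1, hLc] at h1
    have h2 : p ^ (a + b + 1) = p ^ (a + b) * (2 * h + 1) := by rw [pow_succ, ← hh]
    rw [h2] at h1
    have h3 : p ^ (a + b) * 1 ≤ p ^ (a + b) * (u + v) := Nat.mul_le_mul_left _ (by omega)
    nlinarith [Nat.zero_le (u * (K % p ^ (a + b))), Nat.zero_le (v * (L % p ^ (a + b))),
      Nat.zero_le (h * (K % p ^ (a + b))), Nat.zero_le (h * (L % p ^ (a + b)))]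
  · obtain ⟨u, rfl⟩ := Nat.exists_eq_add_of_le hi'
    obtain ⟨z, rfl⟩ := Nat.exists_eq_add_of_le hj'
    have h1 : m + z * L = u * K := by linarith
    have hu : 0 < u := by
      rcases Nat.eq_zero_or_pos u with rfl | hu
      · rw [zero_mul] at h1
        have : 0 < z * L := Nat.mul_pos (by omega) hL0
        omega
      · exact hu
    exact hne (eq_of_add_mul_eq_mul hp hp1.symm hKc1 hLc hs hnc hu (by omega) (by omega) h1)
  · obtain ⟨z, rfl⟩ := Nat.exists_eq_add_of_le hi'
    obtain ⟨u, rfl⟩ := Nat.exists_eq_add_of_le hj'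
    have h1 : m + z * K = u * L := by linarith
    have hu : 0 < u := by
      rcases Nat.eq_zero_or_pos u with rfl | hu
      · rw [zero_mul] at h1
        have : 0 < z * K := Nat.mul_pos (by omega) hK
        omega
      · exact hu
    exact hne (eq_of_add_mul_eq_mul hp hp1.symm hLc hKc1 hs.symm
      (fun l => by rw [add_comm ((i + z) * (L % p ^ l))]; exact hnc l)
      hu (by omega) (by omega) h1).symm
  · have h1 : i * K ≤ h * K := Nat.mul_le_mul_right _ hi'
    have h2 : j * L ≤ h * L := Nat.mul_le_mul_right _ hj'
    rcases hij with hne' | hne'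
    · have : i * K < h * K := Nat.mul_lt_mul_of_pos_right (by omega) hK
      omega
    · have : j * L < h * L := Nat.mul_lt_mul_of_pos_right (by omega) hL0
      omega

theorem bijective_of_eq_prime_pow {F : Type*} [Field F] [Fintype F] {p : ℕ} [Fact p.Prime]
    [CharP F p] (a : ℕ) :
    Function.Bijective (fun x : F => x ^ p ^ a * ((x + 1) ^ p ^ a - x ^ p ^ a)) := by
  have h : (fun x : F => x ^ p ^ a * ((x + 1) ^ p ^ a - x ^ p ^ a))
      = iterateFrobenius F p a := by
    funext x
    rw [add_pow_char_pow, one_pow, add_sub_cancel_left, mul_one, iterateFrobenius_def]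
  rw [h]
  exact Finite.injective_iff_bijective.mp (iterateFrobenius F p a).injective

end

theorem stmt_10 (p e k k' : ℕ) (hp : p.Prime) (hodd : Odd p) (he : 1 ≤ e)
    (hk1 : 1 ≤ k) (hk2 : k ≤ p ^ e - 1) (hgcd : Nat.gcd k (p ^ e - 1) = 1)
    (hk'1 : 1 ≤ k') (hk'2 : k' ≤ p ^ e - 2) (hinv : k' * k ≡ 1 [MOD p ^ e - 1])
    (F : Type*) [Field F] [Fintype F] (hF : Fintype.card F = p ^ e) :
    Function.Bijective (fun x : F => x ^ k * ((x + 1) ^ k - x ^ k)) ↔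
      Function.Bijective (fun x : F => x ^ k' * ((x + 1) ^ k' - x ^ k')) := by
  have : Fact p.Prime := ⟨hp⟩
  have : CharP F p := charP_of_card_eq_prime_pow hF
  have hp3 : 3 ≤ p := by
    have := hp.two_le
    obtain ⟨c, hc⟩ := hodd
    omega
  have hpe : p ≤ p ^ e := Nat.le_self_pow (by omega) p
  have hkQ : k < p ^ e - 1 := by
    refine lt_of_le_of_ne hk2 fun h => ?_
    rw [h, Nat.gcd_self] at hgcd
    omega
  constructor
  · intro h
    obtain ⟨a, rfl⟩ := eq_prime_pow_of_bijective hp hodd hF hk1 hk'1 (by omega)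
      (mul_comm k' k ▸ hinv) h
    exact bijective_of_eq_prime_pow a
  · intro h
    obtain ⟨a, rfl⟩ := eq_prime_pow_of_bijective hp hodd hF hk'1 hk1 hkQ hinv h
    exact bijective_of_eq_prime_pow a
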